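/- arXiv:1301.2835 — 3 statements merged into one kernel-verified Lean document; each statement's English description precedes it below -/
import Mathlib

section
/- Let R = ⊕_{i∈ℤ} R_i be a ℤ-graded (associative, not necessarily unital) ring. Then the nil radical N(R) is a homogeneous ideal: for every a ∈ N(R), each homogeneous component of a belongs to N(R). -/
/-- An iterated-product power for non-unital rings: `ppow a n = a ^ (n + 1)`. -/
def ppow {R : Type*} [NonUnitalRing R] (a : R) : ℕ → R
  | 0 => a
  | n + 1 => ppow a n * a

/-- An element of a (possibly non-unital) ring is nilpotent if some positive power vanishes. -/
def IsNilElem {R : Type*} [NonUnitalRing R] (a : R) : Prop :=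
  ∃ n : ℕ, ppow a n = 0

/-- A two-sided ideal is nil if all of its elements are nilpotent. -/
def TwoSidedIdeal.IsNil {R : Type*} [NonUnitalRing R] (I : TwoSidedIdeal R) : Prop :=
  ∀ x ∈ I, IsNilElem x

/-- The nil radical of a (possibly non-unital) ring: the sum of all its nil two-sided ideals. -/
noncomputable def nilRad (R : Type*) [NonUnitalRing R] : TwoSidedIdeal R :=
  sSup {I : TwoSidedIdeal R | I.IsNil}

/-! ### Powers -/

theorem ppow_mul_ppow {R : Type*} [NonUnitalRing R] (a : R) (n m : ℕ) :
    ppow a n * ppow a m = ppow a (n + m + 1) := by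
  induction m with
  | zero => rfl
  | succ m ih =>
    change ppow a n * (ppow a m * a) = ppow a (n + m + 1) * a
    rw [← mul_assoc, ih]

theorem ppow_succ_left {R : Type*} [NonUnitalRing R] (a : R) (n : ℕ) :
    ppow a (n + 1) = a * ppow a n := by
  have h := ppow_mul_ppow a 0 n
  rw [Nat.zero_add] at h
  exact h.symm

theorem ppow_ppow {R : Type*} [NonUnitalRing R] (a : R) (n m : ℕ) :
    ∃ k, ppow (ppow a n) m = ppow a k := by
  induction m with
  | zero => exact ⟨n, rfl⟩
  | succ m ih =>
    obtain ⟨k, hk⟩ := ih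
    refine ⟨k + n + 1, ?_⟩
    rw [← ppow_mul_ppow, ← hk]
    rfl

theorem isNilElem_of_ppow {R : Type*} [NonUnitalRing R] {a : R} {n : ℕ}
    (h : IsNilElem (ppow a n)) : IsNilElem a := by
  obtain ⟨m, hm⟩ := h
  obtain ⟨k, hk⟩ := ppow_ppow a n m
  exact ⟨k, hk ▸ hm⟩

theorem ppow_add_sub_mem {R : Type*} [NonUnitalRing R] (I : TwoSidedIdeal R) (a b : R)
    (hb : b ∈ I) (n : ℕ) : ppow (a + b) n - ppow a n ∈ I := by
  induction n with
  | zero => simpa [ppow] using hb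
  | succ n ih =>
    have : ppow (a + b) (n + 1) - ppow a (n + 1)
        = (ppow (a + b) n - ppow a n) * (a + b) + ppow a n * b := by
      simp only [ppow]
      noncomm_ring
    rw [this]
    exact I.add_mem (I.mul_mem_right _ _ ih) (I.mul_mem_left _ _ hb)

/-! ### The nil radical is nil -/

theorem isNil_sup {R : Type*} [NonUnitalRing R] {I J : TwoSidedIdeal R}
    (hI : I.IsNil) (hJ : J.IsNil) : (I ⊔ J).IsNil := by
  intro x hx
  obtain ⟨a, ha, b, hb, rfl⟩ := TwoSidedIdeal.mem_sup.1 hx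
  obtain ⟨n, hn⟩ := hI a ha
  have h := ppow_add_sub_mem J a b hb n
  rw [hn, sub_zero] at h
  exact isNilElem_of_ppow (hJ _ h)

theorem isNil_bot {R : Type*} [NonUnitalRing R] : (⊥ : TwoSidedIdeal R).IsNil := by
  intro x hx
  exact ⟨0, by simpa [ppow] using hx⟩

theorem nilRad_isNil (R : Type*) [NonUnitalRing R] : (nilRad R).IsNil := by
  let U : TwoSidedIdeal R := TwoSidedIdeal.mk' {x : R | ∃ I : TwoSidedIdeal R, I.IsNil ∧ x ∈ I}
    ⟨⊥, isNil_bot, TwoSidedIdeal.zero_mem _⟩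
    (by
      rintro x y ⟨I, hI, hx⟩ ⟨J, hJ, hy⟩
      exact ⟨I ⊔ J, isNil_sup hI hJ, TwoSidedIdeal.add_mem _ (TwoSidedIdeal.mem_sup_left hx)
        (TwoSidedIdeal.mem_sup_right hy)⟩)
    (by
      rintro x ⟨I, hI, hx⟩
      exact ⟨I, hI, I.neg_mem hx⟩)
    (by
      rintro x y ⟨I, hI, hx⟩
      exact ⟨I, hI, I.mul_mem_left _ _ hx⟩)
    (by
      rintro x y ⟨I, hI, hx⟩
      exact ⟨I, hI, I.mul_mem_right _ _ hx⟩)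
  have hU : nilRad R ≤ U := by
    refine sSup_le fun I hI => ?_
    rw [TwoSidedIdeal.le_iff]
    intro x hx
    exact (TwoSidedIdeal.mem_mk' _ _ _ _ _ _ _).2 ⟨I, hI, hx⟩
  intro x hx
  have hx' : x ∈ U := (TwoSidedIdeal.le_iff.1 hU) hx
  obtain ⟨I, hI, hxI⟩ := (TwoSidedIdeal.mem_mk' _ _ _ _ _ _ _).1 hx'
  exact hI x hxI

/-- An ideal which is nil modulo the nil radical is contained in it. -/
theorem mem_nilRad_of_ideal {R : Type*} [NonUnitalRing R] (I : TwoSidedIdeal R)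
    (h : ∀ x ∈ I, ∃ n, ppow x n ∈ nilRad R) : ∀ x ∈ I, x ∈ nilRad R := by
  have hI : I.IsNil := fun x hx => by
    obtain ⟨n, hn⟩ := h x hx
    exact isNilElem_of_ppow (nilRad_isNil R _ hn)
  have : I ≤ nilRad R := le_sSup hI
  exact fun x hx => (TwoSidedIdeal.le_iff.1 this) hx

theorem mem_nilRad_of_mul_mul {R : Type*} [NonUnitalRing R] (g : R)
    (h : ∀ u v, u * g * v ∈ nilRad R) : g ∈ nilRad R := by
  let U : TwoSidedIdeal R := TwoSidedIdeal.mk' {x : R | ∀ u v, u * x * v ∈ nilRad R}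
    (by intro u v; simp)
    (by
      intro x y hx hy u v
      rw [mul_add, add_mul]
      exact TwoSidedIdeal.add_mem _ (hx u v) (hy u v))
    (by
      intro x hx u v
      rw [mul_neg, neg_mul]
      exact TwoSidedIdeal.neg_mem _ (hx u v))
    (by
      intro x y hy u v
      have := hy (u * x) v
      simpa only [mul_assoc] using this)
    (by
      intro x y hx u v
      have := hx u (y * v)
      simpa only [mul_assoc] using this)
  refine mem_nilRad_of_ideal U ?_ g ((TwoSidedIdeal.mem_mk' _ _ _ _ _ _ _).2 h)
  intro x hx
  have hx' := (TwoSidedIdeal.mem_mk' _ _ _ _ _ _ _).1 hx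
  exact ⟨2, hx' x x⟩

/-- If every element of `RgR` has a power in the nil radical, then `g` is in the nil radical. -/
theorem mem_nilRad_of_span {R : Type*} [NonUnitalRing R] (g : R)
    (h : ∀ x ∈ AddSubgroup.closure {w : R | ∃ u v, w = u * g * v}, ∃ n, ppow x n ∈ nilRad R) :
    g ∈ nilRad R := by
  let T := AddSubgroup.closure {w : R | ∃ u v, w = u * g * v}
  let U : TwoSidedIdeal R := TwoSidedIdeal.mk' (T : Set R) T.zero_mem
    (fun hx hy => T.add_mem hx hy) (fun hx => T.neg_mem hx)
    (by
      intro x y hy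
      change y ∈ T at hy
      change x * y ∈ T
      induction hy using AddSubgroup.closure_induction with
      | mem w hw =>
        obtain ⟨u, v, rfl⟩ := hw
        exact AddSubgroup.subset_closure ⟨x * u, v, by simp only [mul_assoc]⟩
      | zero => simp
      | add a b _ _ ha hb => rw [mul_add]; exact T.add_mem ha hb
      | neg a _ ha => rw [mul_neg]; exact T.neg_mem ha)
    (by
      intro y x hy
      change y ∈ T at hy
      change y * x ∈ T
      induction hy using AddSubgroup.closure_induction with
      | mem w hw =>
        obtain ⟨u, v, rfl⟩ := hw
        exact AddSubgroup.subset_closure ⟨u, v * x, by simp only [mul_assoc]⟩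
      | zero => simp
      | add a b _ _ ha hb => rw [add_mul]; exact T.add_mem ha hb
      | neg a _ ha => rw [neg_mul]; exact T.neg_mem ha)
  have hU : ∀ x, x ∈ U ↔ x ∈ T := fun x => TwoSidedIdeal.mem_mk' _ _ _ _ _ _ _
  refine mem_nilRad_of_mul_mul g fun u v => mem_nilRad_of_ideal U ?_ _ ?_
  · intro x hx
    exact h x ((hU x).1 hx)
  · exact (hU _).2 (AddSubgroup.subset_closure ⟨u, v, rfl⟩)

/-- The nil radical is a semiprime ideal. -/
theorem nilRad_semiprime {R : Type*} [NonUnitalRing R] (a : R)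
    (h : ∀ s, a * s * a ∈ nilRad R) : a ∈ nilRad R := by
  refine mem_nilRad_of_span a fun x hx => ⟨1, ?_⟩
  have key : ∀ y ∈ AddSubgroup.closure {w : R | ∃ u v, w = u * a * v},
      ∀ s, a * s * y ∈ nilRad R := by
    intro y hy
    induction hy using AddSubgroup.closure_induction with
    | mem w hw =>
      obtain ⟨u, v, rfl⟩ := hw
      intro s
      have := TwoSidedIdeal.mul_mem_right _ _ v (h (s * u))
      simpa only [mul_assoc] using this
    | zero => intro s; simp
    | add b c _ _ hb hc =>
      intro s
      rw [mul_add]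
      exact TwoSidedIdeal.add_mem _ (hb s) (hc s)
    | neg b _ hb =>
      intro s
      rw [mul_neg]
      exact TwoSidedIdeal.neg_mem _ (hb s)
  have key2 : ∀ z ∈ AddSubgroup.closure {w : R | ∃ u v, w = u * a * v},
      z * x ∈ nilRad R := by
    intro z hz
    induction hz using AddSubgroup.closure_induction with
    | mem w hw =>
      obtain ⟨u, v, rfl⟩ := hw
      have := TwoSidedIdeal.mul_mem_left _ u _ (key x hx v)
      simpa only [mul_assoc] using this
    | zero => simp
    | add b c _ _ hb hc => rw [add_mul]; exact TwoSidedIdeal.add_mem _ hb hc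
    | neg b _ hb => rw [neg_mul]; exact TwoSidedIdeal.neg_mem _ hb
  exact key2 x hx

/-! ### Homogeneous components -/

section graded

variable {R : Type*} [NonUnitalRing R] (ℳ : ℤ → AddSubgroup R)

/-- The homogeneous component of degree `i`. -/
def hcomp [DirectSum.Decomposition ℳ] (i : ℤ) : R →+ R where
  toFun a := (DirectSum.decompose ℳ a i : R)
  map_zero' := by simp
  map_add' := by simp

theorem hcomp_mem [DirectSum.Decomposition ℳ] (i : ℤ) (a : R) : hcomp ℳ i a ∈ ℳ i :=
  (DirectSum.decompose ℳ a i).2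

theorem hcomp_same [DirectSum.Decomposition ℳ] {i : ℤ} {a : R} (h : a ∈ ℳ i) :
    hcomp ℳ i a = a := DirectSum.decompose_of_mem_same ℳ h

theorem hcomp_ne [DirectSum.Decomposition ℳ] {i j : ℤ} {a : R} (h : a ∈ ℳ i) (hij : i ≠ j) :
    hcomp ℳ j a = 0 := DirectSum.decompose_of_mem_ne ℳ h hij

theorem hind [DirectSum.Decomposition ℳ] {p : R → Prop} (zero : p 0)
    (hom : ∀ i, ∀ m ∈ ℳ i, p m) (add : ∀ a b, p a → p b → p (a + b)) (a : R) : p a :=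
  DirectSum.Decomposition.inductionOn ℳ zero (fun {i} m => hom i m m.2) add a

theorem exists_support [DirectSum.Decomposition ℳ] (a : R) :
    ∃ s : Finset ℤ, ∀ i ∉ s, hcomp ℳ i a = 0 := by
  classical
  refine hind ℳ (p := fun a => ∃ s : Finset ℤ, ∀ i ∉ s, hcomp ℳ i a = 0) ?_ ?_ ?_ a
  · exact ⟨∅, fun i _ => map_zero _⟩
  · intro i m hm
    refine ⟨{i}, fun j hj => hcomp_ne ℳ hm ?_⟩
    rintro rfl
    simp at hj
  · rintro a b ⟨s, hs⟩ ⟨t, ht⟩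
    refine ⟨s ∪ t, fun i hi => ?_⟩
    rw [Finset.mem_union, not_or] at hi
    rw [map_add, hs i hi.1, ht i hi.2, add_zero]

theorem mem_of_hcomp [DirectSum.Decomposition ℳ] (I : TwoSidedIdeal R) (a : R)
    (h : ∀ i, hcomp ℳ i a ∈ I) : a ∈ I := by
  classical
  have := DirectSum.sum_support_decompose ℳ a
  rw [← this]
  exact sum_mem fun i _ => h i

theorem eq_zero_of_hcomp [DirectSum.Decomposition ℳ] (a : R)
    (h : ∀ i, hcomp ℳ i a = 0) : a = 0 := by
  classical
  have := DirectSum.sum_support_decompose ℳ a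
  rw [← this]
  exact Finset.sum_eq_zero fun i _ => h i

variable [SetLike.GradedMul ℳ] [DirectSum.Decomposition ℳ]

theorem hmul_mem {i j : ℤ} {a b : R} (ha : a ∈ ℳ i) (hb : b ∈ ℳ j) : a * b ∈ ℳ (i + j) :=
  SetLike.GradedMul.mul_mem ha hb

theorem hcomp_mul_left {j : ℤ} {r : R} (hr : r ∈ ℳ j) (a : R) (i : ℤ) :
    hcomp ℳ i (r * a) = r * hcomp ℳ (i - j) a := by
  refine hind ℳ (p := fun a => hcomp ℳ i (r * a) = r * hcomp ℳ (i - j) a) ?_ ?_ ?_ a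
  · simp
  · intro k m hm
    by_cases hk : k = i - j
    · subst hk
      have h := hmul_mem ℳ hr hm
      rw [add_sub_cancel] at h
      rw [hcomp_same ℳ hm, hcomp_same ℳ h]
    · rw [hcomp_ne ℳ hm hk, mul_zero, hcomp_ne ℳ (hmul_mem ℳ hr hm)]
      omega
  · intro a b ha hb
    rw [mul_add, map_add, map_add, mul_add, ha, hb]

theorem hcomp_mul_right {j : ℤ} {r : R} (hr : r ∈ ℳ j) (a : R) (i : ℤ) :
    hcomp ℳ i (a * r) = hcomp ℳ (i - j) a * r := by
  refine hind ℳ (p := fun a => hcomp ℳ i (a * r) = hcomp ℳ (i - j) a * r) ?_ ?_ ?_ a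
  · simp
  · intro k m hm
    by_cases hk : k = i - j
    · subst hk
      have h := hmul_mem ℳ hm hr
      rw [sub_add_cancel] at h
      rw [hcomp_same ℳ hm, hcomp_same ℳ h]
    · rw [hcomp_ne ℳ hm hk, zero_mul, hcomp_ne ℳ (hmul_mem ℳ hm hr)]
      omega
  · intro a b ha hb
    rw [add_mul, map_add, map_add, add_mul, ha, hb]

/-- The largest homogeneous ideal inside the nil radical. -/
def grNil : TwoSidedIdeal R := TwoSidedIdeal.mk' {a : R | ∀ i, hcomp ℳ i a ∈ nilRad R}
  (by intro i; simp)
  (by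
    intro x y hx hy i
    rw [map_add]
    exact TwoSidedIdeal.add_mem _ (hx i) (hy i))
  (by
    intro x hx i
    rw [map_neg]
    exact TwoSidedIdeal.neg_mem _ (hx i))
  (by
    intro x y hy
    refine hind ℳ (p := fun x => ∀ i, hcomp ℳ i (x * y) ∈ nilRad R) ?_ ?_ ?_ x
    · intro i; simp
    · intro j m hm i
      rw [hcomp_mul_left ℳ hm]
      exact TwoSidedIdeal.mul_mem_left _ _ _ (hy _)
    · intro a b ha hb i
      rw [add_mul, map_add]
      exact TwoSidedIdeal.add_mem _ (ha i) (hb i))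
  (by
    intro y x hy
    refine hind ℳ (p := fun x => ∀ i, hcomp ℳ i (y * x) ∈ nilRad R) ?_ ?_ ?_ x
    · intro i; simp
    · intro j m hm i
      rw [hcomp_mul_right ℳ hm]
      exact TwoSidedIdeal.mul_mem_right _ _ _ (hy _)
    · intro a b ha hb i
      rw [mul_add, map_add]
      exact TwoSidedIdeal.add_mem _ (ha i) (hb i))

theorem mem_grNil {a : R} : a ∈ grNil ℳ ↔ ∀ i, hcomp ℳ i a ∈ nilRad R :=
  TwoSidedIdeal.mem_mk' _ _ _ _ _ _ _

theorem grNil_le {a : R} (h : a ∈ grNil ℳ) : a ∈ nilRad R :=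
  mem_of_hcomp ℳ _ a ((mem_grNil ℳ).1 h)

theorem mem_grNil_of_hom {a : R} {i : ℤ} (ha : a ∈ ℳ i) (h : a ∈ nilRad R) : a ∈ grNil ℳ := by
  rw [mem_grNil]
  intro j
  by_cases hij : i = j
  · subst hij
    rwa [hcomp_same ℳ ha]
  · rw [hcomp_ne ℳ ha hij]
    exact TwoSidedIdeal.zero_mem _

/-- `a` has no components of degree below `A`, and `b` is its component of degree `A`. -/
def Low (a : R) (A : ℤ) (b : R) : Prop := (∀ i < A, hcomp ℳ i a = 0) ∧ hcomp ℳ A a = b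

theorem low_hom {a : R} {A : ℤ} (h : a ∈ ℳ A) : Low ℳ a A a :=
  ⟨fun _ hi => hcomp_ne ℳ h (ne_of_gt hi), hcomp_same ℳ h⟩

theorem low_mul {a b a' b' : R} {A B : ℤ} (ha : Low ℳ a A a') (hb : Low ℳ b B b') :
    Low ℳ (a * b) (A + B) (a' * b') := by
  have key : ∀ b : R, (∀ i < B, hcomp ℳ i b = 0) → ∀ i ≤ A + B,
      hcomp ℳ i (a * b) = hcomp ℳ A a * hcomp ℳ (i - A) b := by
    intro b hb i hi
    classical
    have hs := DirectSum.sum_support_decompose ℳ b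
    have h1 : hcomp ℳ i (a * b)
        = ∑ j ∈ (DirectSum.decompose ℳ b).support, hcomp ℳ (i - j) a * hcomp ℳ j b := by
      conv_lhs => rw [← hs]
      rw [Finset.mul_sum, map_sum]
      exact Finset.sum_congr rfl fun j _ => hcomp_mul_right ℳ (hcomp_mem ℳ j b) a i
    rw [h1, Finset.sum_eq_single (i - A)]
    · rw [sub_sub_cancel]
    · intro j _ hj
      by_cases hjB : j < B
      · rw [hb j hjB, mul_zero]
      · rw [ha.1 (i - j) (by omega), zero_mul]
    · intro hn
      have : hcomp ℳ (i - A) b = 0 := by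
        rw [DFinsupp.notMem_support_iff] at hn
        change ((DirectSum.decompose ℳ b (i - A) : ℳ (i - A)) : R) = 0
        rw [hn]; rfl
      rw [this, mul_zero]
  constructor
  · intro i hi
    rw [key b hb.1 i hi.le, hb.1 _ (by omega), mul_zero]
  · rw [key b hb.1 _ le_rfl, add_sub_cancel_left, ha.2, hb.2]

/-- Main cancellation lemma. -/
theorem cancel_lemma {f g : R} {e : ℤ} (hlow : Low ℳ f e g)
    (hcomm : ∀ r, f * r * g - g * r * f ∈ grNil ℳ) (z : R)
    (hz : ∀ u v s t, z * u * f * v * s * g * t ∈ grNil ℳ) :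
    ∀ u v, z * u * g * v ∈ grNil ℳ := by
  obtain ⟨s, hs⟩ := exists_support ℳ z
  have hg : g ∈ ℳ e := hlow.2 ▸ hcomp_mem ℳ e f
  induction s using Finset.induction_on_min generalizing z with
  | empty =>
    intro u v
    have : z = 0 := eq_zero_of_hcomp ℳ z fun i => hs i (by simp)
    simpa [this] using TwoSidedIdeal.zero_mem _
  | insert D s hD ih =>
    have hzl : Low ℳ z D (hcomp ℳ D z) := by
      refine ⟨fun i hi => hs i ?_, rfl⟩
      rw [Finset.mem_insert, not_or]
      exact ⟨hi.ne, fun h => absurd (hD i h) (by omega)⟩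
    have hDm := hcomp_mem ℳ D z
    set w := hcomp ℳ D z with hw
    have good : ∀ u v, w * u * g * v ∈ grNil ℳ := by
      have hom : ∀ i, ∀ u ∈ ℳ i, ∀ j, ∀ v ∈ ℳ j, w * u * g * v ∈ grNil ℳ := by
        intro i u hu j v hv
        refine mem_grNil_of_hom ℳ (hmul_mem ℳ (hmul_mem ℳ (hmul_mem ℳ hDm hu) hg) hv) ?_
        have h1 : ∀ k, ∀ s ∈ ℳ k, ∀ l, ∀ t ∈ ℳ l,
            w * u * g * v * s * g * t ∈ nilRad R := by
          intro k s hs l t ht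
          have hl := low_mul ℳ (low_mul ℳ (low_mul ℳ (low_mul ℳ (low_mul ℳ (low_mul ℳ hzl
            (low_hom ℳ hu)) hlow) (low_hom ℳ hv)) (low_hom ℳ hs)) (low_hom ℳ hg)) (low_hom ℳ ht)
          rw [← hl.2]
          exact (mem_grNil ℳ).1 (hz u v s t) _
        have h2 : ∀ k, ∀ s ∈ ℳ k, ∀ t, w * u * g * v * s * g * t ∈ nilRad R := by
          intro k s hs t
          refine hind ℳ (p := fun t => w * u * g * v * s * g * t ∈ nilRad R) ?_ (h1 k s hs) ?_ t
          · simp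
          · intro a b ha hb
            rw [mul_add]
            exact TwoSidedIdeal.add_mem _ ha hb
        have h3 : ∀ s t, w * u * g * v * s * g * t ∈ nilRad R := by
          intro s t
          refine hind ℳ (p := fun s => w * u * g * v * s * g * t ∈ nilRad R) ?_
            (fun k s hs => h2 k s hs t) ?_ s
          · simp
          · intro a b ha hb
            rw [mul_add, add_mul, add_mul]
            exact TwoSidedIdeal.add_mem _ ha hb
        refine nilRad_semiprime _ fun s => ?_
        have := h3 (s * w * u) v
        simpa only [mul_assoc] using this
      intro u v
      refine hind ℳ (p := fun u => w * u * g * v ∈ grNil ℳ) ?_ ?_ ?_ u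
      · simp
      · intro i u hu
        refine hind ℳ (p := fun v => w * u * g * v ∈ grNil ℳ) ?_ (hom i u hu) ?_ v
        · simp
        · intro a b ha hb
          rw [mul_add]
          exact TwoSidedIdeal.add_mem _ ha hb
      · intro a b ha hb
        rw [mul_add, add_mul, add_mul]
        exact TwoSidedIdeal.add_mem _ ha hb
    have hrest : ∀ u v, (z - w) * u * g * v ∈ grNil ℳ := by
      apply ih
      · intro u v s t
        have h1 := hz u v s t
        have h2 : w * u * f * v * s * g * t ∈ grNil ℳ := by
          have h3 := TwoSidedIdeal.mul_mem_right _ _ t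
            (TwoSidedIdeal.mul_mem_left _ (w * u) _ (hcomm (v * s)))
          have h4 := TwoSidedIdeal.mul_mem_right _ _ (f * t) (good u (v * s))
          have h5 := TwoSidedIdeal.add_mem _ h3 h4
          have : w * u * (f * (v * s) * g - g * (v * s) * f) * t
              + w * u * g * (v * s) * (f * t) = w * u * f * v * s * g * t := by
            noncomm_ring
          rwa [this] at h5
        have h6 := TwoSidedIdeal.sub_mem _ h1 h2
        simpa only [sub_mul] using h6
      · intro i hi
        rw [map_sub]
        by_cases hiD : i = D
        · rw [hiD, hcomp_same ℳ hDm, ← hw, sub_self]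
        · rw [hcomp_ne ℳ hDm (Ne.symm hiD), hs i (by simp [hiD, hi]), sub_zero]
    intro u v
    have := TwoSidedIdeal.add_mem _ (hrest u v) (good u v)
    rwa [← add_mul, ← add_mul, ← add_mul, sub_add_cancel] at this

theorem low_mem {f g : R} {e : ℤ} (hf : f ∈ nilRad R) (hlow : Low ℳ f e g)
    (hcomm : ∀ r, f * r * g - g * r * f ∈ grNil ℳ) : g ∈ nilRad R := by
  refine mem_nilRad_of_span g fun x hx => ?_
  -- the companion `y` of `x`
  have hy : ∃ y ∈ nilRad R, ∀ u v, y * u * g * v - x * u * f * v ∈ grNil ℳ := by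
    induction hx using AddSubgroup.closure_induction with
    | mem w hw =>
      obtain ⟨a, b, rfl⟩ := hw
      refine ⟨a * f * b, TwoSidedIdeal.mul_mem_right _ _ _ (TwoSidedIdeal.mul_mem_left _ _ _ hf),
        fun u v => ?_⟩
      have h := TwoSidedIdeal.mul_mem_right _ _ v
        (TwoSidedIdeal.mul_mem_left _ a _ (hcomm (b * u)))
      have h2 : a * (f * (b * u) * g - g * (b * u) * f) * v
          = a * f * b * u * g * v - a * g * b * u * f * v := by noncomm_ring
      rwa [h2] at h
    | zero => exact ⟨0, TwoSidedIdeal.zero_mem _, fun u v => by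
        simp⟩
    | add a b _ _ ha hb =>
      obtain ⟨y, hy, h⟩ := ha
      obtain ⟨y', hy', h'⟩ := hb
      refine ⟨y + y', TwoSidedIdeal.add_mem _ hy hy', fun u v => ?_⟩
      have := TwoSidedIdeal.add_mem _ (h u v) (h' u v)
      have h2 : (y + y') * u * g * v - (a + b) * u * f * v
        = y * u * g * v - a * u * f * v + (y' * u * g * v - b * u * f * v) := by noncomm_ring
      rwa [h2]
    | neg a _ ha =>
      obtain ⟨y, hy, h⟩ := ha
      refine ⟨-y, TwoSidedIdeal.neg_mem _ hy, fun u v => ?_⟩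
      have := TwoSidedIdeal.neg_mem _ (h u v)
      have h2 : -y * u * g * v - -a * u * f * v = -(y * u * g * v - a * u * f * v) := by
        noncomm_ring
      rwa [h2]
  obtain ⟨y, hyN, hrel⟩ := hy
  obtain ⟨n, hn⟩ := nilRad_isNil R y hyN
  have cancel : ∀ z, (∀ u v, z * u * f * v ∈ grNil ℳ) → ∀ u v, z * u * g * v ∈ grNil ℳ := by
    intro z hz
    refine cancel_lemma ℳ hlow hcomm z fun u v s t => ?_
    have := TwoSidedIdeal.mul_mem_right _ _ (s * g * t) (hz u v)
    simpa only [mul_assoc] using this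
  have base : ∀ c, (∀ u v, c * y * u * g * v ∈ grNil ℳ) →
      ∀ u v, c * x * u * g * v ∈ grNil ℳ := by
    intro c hc
    refine cancel _ fun u v => ?_
    have h := TwoSidedIdeal.sub_mem _ (hc u v) (TwoSidedIdeal.mul_mem_left _ c _ (hrel u v))
    have h2 : c * y * u * g * v - c * (y * u * g * v - x * u * f * v) = c * x * u * f * v := by
      noncomm_ring
    rwa [h2] at h
  have step : ∀ c w, (∀ u v, c * y * w * u * g * v ∈ grNil ℳ) →
      ∀ u v, c * x * w * u * g * v ∈ grNil ℳ := by
    intro c w hc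
    refine cancel _ fun u v => ?_
    have h := TwoSidedIdeal.sub_mem _ (hc u v)
      (TwoSidedIdeal.mul_mem_left _ c _ (hrel (w * u) v))
    have h2 : c * y * w * u * g * v - c * (y * (w * u) * g * v - x * (w * u) * f * v)
        = c * x * w * u * f * v := by
      noncomm_ring
    rwa [h2] at h
  have claim : ∀ n c, (∀ u v, c * ppow y n * u * g * v ∈ grNil ℳ) →
      ∀ u v, c * ppow x n * u * g * v ∈ grNil ℳ := by
    intro n
    induction n with
    | zero => exact base
    | succ n ih =>
      intro c hc
      simp only [ppow_succ_left] at hc ⊢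
      have h1 := ih (c * y) (by simpa only [mul_assoc] using hc)
      have h2 := step c _ h1
      simpa only [mul_assoc] using h2
  have fin := claim n x (fun u v => by
    rw [hn]
    simp)
  have all : ∀ x' ∈ AddSubgroup.closure {w : R | ∃ u v, w = u * g * v},
      x * ppow x n * x' ∈ grNil ℳ := by
    intro x' hx'
    induction hx' using AddSubgroup.closure_induction with
    | mem w hw =>
      obtain ⟨a, b, rfl⟩ := hw
      simpa only [mul_assoc] using fin a b
    | zero => simp
    | add a b _ _ ha hb => rw [mul_add]; exact TwoSidedIdeal.add_mem _ ha hb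
    | neg a _ ha => rw [mul_neg]; exact TwoSidedIdeal.neg_mem _ ha
  refine ⟨n + 2, grNil_le ℳ ?_⟩
  have := all x hx
  rw [← ppow_succ_left] at this
  exact this

theorem nilRad_le_grNil : ∀ (n : ℕ) (s : Finset ℤ), s.card = n → ∀ f ∈ nilRad R,
    (∀ i ∉ s, hcomp ℳ i f = 0) → f ∈ grNil ℳ := by
  intro n
  induction n using Nat.strong_induction_on with
  | _ n IH =>
  intro s hsn f hf hs
  rcases s.eq_empty_or_nonempty with rfl | hne
  · rw [eq_zero_of_hcomp ℳ f fun i => hs i (by simp)]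
    exact TwoSidedIdeal.zero_mem _
  classical
  set e := s.min' hne with he
  have hes : e ∈ s := s.min'_mem hne
  have hcard : (s.erase e).card < n := hsn ▸ Finset.card_erase_lt_of_mem hes
  have hge := hcomp_mem ℳ e f
  have hlow : Low ℳ f e (hcomp ℳ e f) := by
    refine ⟨fun i hi => hs i fun h => ?_, rfl⟩
    exact absurd (s.min'_le i h) (by omega)
  set g := hcomp ℳ e f with hg
  have hcomm : ∀ r, f * r * g - g * r * f ∈ grNil ℳ := by
    intro r
    refine hind ℳ (p := fun r => f * r * g - g * r * f ∈ grNil ℳ) ?_ ?_ ?_ r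
    · simp
    · intro k r hr
      refine IH _ (lt_of_le_of_lt Finset.card_image_le hcard)
        ((s.erase e).image (fun i => i + k + e)) rfl _ ?_ ?_
      · exact TwoSidedIdeal.sub_mem _
          (TwoSidedIdeal.mul_mem_right _ _ _ (TwoSidedIdeal.mul_mem_right _ _ _ hf))
          (TwoSidedIdeal.mul_mem_left _ _ _ hf)
      · intro i hi
        rw [map_sub, hcomp_mul_right ℳ hge, hcomp_mul_right ℳ hr,
          hcomp_mul_left ℳ (hmul_mem ℳ hge hr)]
        have e1 : i - (e + k) = i - e - k := by ring
        rw [e1]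
        by_cases h : i - e - k = e
        · rw [h, ← hg, sub_self]
        · have : i - e - k ∉ s := by
            intro h'
            apply hi
            rw [Finset.mem_image]
            exact ⟨i - e - k, Finset.mem_erase.2 ⟨h, h'⟩, by ring⟩
          rw [hs _ this]
          simp
    · intro a b ha hb
      have h2 : f * (a + b) * g - g * (a + b) * f
        = f * a * g - g * a * f + (f * b * g - g * b * f) := by noncomm_ring
      rw [h2]
      exact TwoSidedIdeal.add_mem _ ha hb
  have hgN : g ∈ nilRad R := low_mem ℳ hf hlow hcomm
  have hrest : f - g ∈ grNil ℳ := by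
    refine IH _ hcard (s.erase e) rfl _ (TwoSidedIdeal.sub_mem _ hf hgN) fun i hi => ?_
    rw [map_sub]
    by_cases hie : i = e
    · rw [hie, hcomp_same ℳ hge, ← hg, sub_self]
    · rw [hcomp_ne ℳ hge (Ne.symm hie), hs i (fun h => hi (Finset.mem_erase.2 ⟨hie, h⟩)), sub_zero]
  have := TwoSidedIdeal.add_mem _ hrest (mem_grNil_of_hom ℳ hge hgN)
  rwa [sub_add_cancel] at this

end graded

/-- **The nil radical of a `ℤ`-graded ring is homogeneous.**  If `R = ⊕ᵢ Rᵢ` is a `ℤ`-graded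
(associative, not necessarily unital) ring, then every homogeneous component of every element of
the nil radical again lies in the nil radical. -/
theorem nilRad_homogeneous_of_zgraded {R : Type*} [NonUnitalRing R]
    (ℳ : ℤ → AddSubgroup R) [SetLike.GradedMul ℳ] [DirectSum.Decomposition ℳ]
    (a : R) (ha : a ∈ nilRad R) (i : ℤ) :
    (DirectSum.decompose ℳ a i : R) ∈ nilRad R := by
  obtain ⟨s, hs⟩ := exists_support ℳ a
  exact (mem_grNil ℳ).1 (nilRad_le_grNil ℳ _ s rfl a ha hs) i
end

section
/- Let G be a free abelian group and let R = ⊕_{g∈G} R_g be a G-graded (associative, not necessarily unital) ring. Then the nil radical N(R) is a homogeneous ideal: for every a ∈ N(R), each homogeneous component of a belongs to N(R). -/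
namespace NilRadAux

theorem inr_ppow {R : Type*} [NonUnitalRing R] (a : R) (n : ℕ) :
    ((ppow a n : R) : Unitization ℤ R) = (a : Unitization ℤ R) ^ (n + 1) := by
  induction n with
  | zero => simp [ppow]
  | succ n ih => rw [ppow, Unitization.inr_mul, ih, ← pow_succ]

theorem ppow_ppow {R : Type*} [NonUnitalRing R] (a : R) (n m : ℕ) :
    ppow (ppow a n) m = ppow a ((n + 1) * (m + 1) - 1) := by
  apply Unitization.inr_injective (R := ℤ)
  rw [inr_ppow, inr_ppow, inr_ppow, ← pow_mul]
  congr 1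

theorem nil_of_ppow_mem {R : Type*} [NonUnitalRing R] {I : TwoSidedIdeal R} (hI : I.IsNil)
    {x : R} {n : ℕ} (h : ppow x n ∈ I) : IsNilElem x := by
  obtain ⟨m, hm⟩ := hI _ h
  exact ⟨_, (ppow_ppow x n m) ▸ hm⟩

theorem ppow_add_sub_mem {R : Type*} [NonUnitalRing R] {I : TwoSidedIdeal R} {b : R} (hb : b ∈ I)
    (y : R) (n : ℕ) : ppow (b + y) n - ppow y n ∈ I := by
  induction n with
  | zero => simpa [ppow] using hb
  | succ n ih =>
    have : ppow (b + y) (n + 1) - ppow y (n + 1)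
        = ppow (b + y) n * b + (ppow (b + y) n - ppow y n) * y := by
      simp only [ppow]; noncomm_ring
    rw [this]
    exact I.add_mem (I.mul_mem_left _ _ hb) (I.mul_mem_right _ _ ih)

/-- The basic extension lemma: `I + f(J)` is a nil ideal. -/
theorem exists_nil_ext {R : Type*} [NonUnitalRing R] {I J : TwoSidedIdeal R} (hI : I.IsNil)
    (f : R →+ R)
    (hl : ∀ r, ∀ a ∈ J, ∃ a' ∈ J, r * f a - f a' ∈ I)
    (hr : ∀ r, ∀ a ∈ J, ∃ a' ∈ J, f a * r - f a' ∈ I)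
    (hn : ∀ a ∈ J, ∃ n, ppow (f a) n ∈ I) :
    ∃ K : TwoSidedIdeal R, K.IsNil ∧ ∀ b ∈ I, ∀ a ∈ J, b + f a ∈ K := by
  refine ⟨TwoSidedIdeal.mk' {x | ∃ b ∈ I, ∃ a ∈ J, x = b + f a} ?_ ?_ ?_ ?_ ?_, ?_, ?_⟩
  · exact ⟨0, I.zero_mem, 0, J.zero_mem, by simp⟩
  · rintro _ _ ⟨b, hb, a, ha, rfl⟩ ⟨b', hb', a', ha', rfl⟩
    exact ⟨b + b', I.add_mem hb hb', a + a', J.add_mem ha ha', by rw [map_add]; abel⟩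
  · rintro _ ⟨b, hb, a, ha, rfl⟩
    exact ⟨-b, I.neg_mem hb, -a, J.neg_mem ha, by rw [map_neg]; abel⟩
  · rintro r _ ⟨b, hb, a, ha, rfl⟩
    obtain ⟨a', ha', h⟩ := hl r a ha
    exact ⟨r * b + (r * f a - f a'), I.add_mem (I.mul_mem_left _ _ hb) h, a', ha', by
      rw [mul_add]; abel⟩
  · rintro _ r ⟨b, hb, a, ha, rfl⟩
    obtain ⟨a', ha', h⟩ := hr r a ha
    exact ⟨b * r + (f a * r - f a'), I.add_mem (I.mul_mem_right _ _ hb) h, a', ha', by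
      rw [add_mul]; abel⟩
  · intro x hx
    rw [TwoSidedIdeal.mem_mk'] at hx
    obtain ⟨b, hb, a, ha, rfl⟩ := hx
    obtain ⟨n, hn⟩ := hn a ha
    refine nil_of_ppow_mem hI (n := n) ?_
    have := I.add_mem (ppow_add_sub_mem hb (f a) n) hn
    simpa using this
  · intro b hb a ha
    rw [TwoSidedIdeal.mem_mk']
    exact ⟨b, hb, a, ha, rfl⟩

theorem le_nilRad {R : Type*} [NonUnitalRing R] {I : TwoSidedIdeal R} (hI : I.IsNil) :
    I ≤ nilRad R := le_sSup hI

theorem exists_nil_sup {R : Type*} [NonUnitalRing R] {I J : TwoSidedIdeal R} (hI : I.IsNil)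
    (hJ : J.IsNil) : ∃ K : TwoSidedIdeal R, K.IsNil ∧ ∀ b ∈ I, ∀ a ∈ J, b + a ∈ K := by
  refine exists_nil_ext hI (AddMonoidHom.id R) ?_ ?_ ?_
  · intro r a ha
    exact ⟨r * a, J.mul_mem_left _ _ ha, by simpa using I.zero_mem⟩
  · intro r a ha
    exact ⟨a * r, J.mul_mem_right _ _ ha, by simpa using I.zero_mem⟩
  · intro a ha
    obtain ⟨n, hn⟩ := hJ a ha
    exact ⟨n, by simpa [hn] using I.zero_mem⟩

theorem nilRad_isNil (R : Type*) [NonUnitalRing R] : (nilRad R).IsNil := by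
  let M : TwoSidedIdeal R := TwoSidedIdeal.mk' {x | ∃ I : TwoSidedIdeal R, I.IsNil ∧ x ∈ I}
    ⟨⊥, fun x hx => ⟨0, by simpa [ppow] using hx⟩, TwoSidedIdeal.zero_mem _⟩
    (by
      rintro x y ⟨I, hI, hx⟩ ⟨J, hJ, hy⟩
      obtain ⟨K, hK, h⟩ := exists_nil_sup hI hJ
      exact ⟨K, hK, h _ hx _ hy⟩)
    (by
      rintro x ⟨I, hI, hx⟩
      exact ⟨I, hI, I.neg_mem hx⟩)
    (by
      rintro r x ⟨I, hI, hx⟩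
      exact ⟨I, hI, I.mul_mem_left _ _ hx⟩)
    (by
      rintro x r ⟨I, hI, hx⟩
      exact ⟨I, hI, I.mul_mem_right _ _ hx⟩)
  have h : nilRad R ≤ M := by
    refine sSup_le fun I hI x hx => ?_
    exact (TwoSidedIdeal.mem_mk' _ _ _ _ _ _ _).2 ⟨I, hI, hx⟩
  intro x hx
  obtain ⟨I, hI, hxI⟩ := (TwoSidedIdeal.mem_mk' _ _ _ _ _ _ _).1 (h hx)
  exact hI x hxI

/-- The nil radical is stable under every higher derivation. -/
theorem higher_mem {R : Type*} [NonUnitalRing R] (D : ℕ → R →+ R) (h0 : ∀ a, D 0 a = a)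
    (hmul : ∀ k a b, D k (a * b) = ∑ p ∈ Finset.HasAntidiagonal.antidiagonal k, D p.1 a * D p.2 b)
    (k : ℕ) : ∀ a ∈ nilRad R, D k a ∈ nilRad R := by
  induction k using Nat.strong_induction_on with
  | _ k ih =>
  set N := nilRad R with hN
  have key : ∀ a ∈ N, ∀ n : ℕ, (∀ m < k * (n + 1), D m (ppow a n) ∈ N) ∧
      D (k * (n + 1)) (ppow a n) - ppow (D k a) n ∈ N := by
    intro a ha n
    induction n with
    | zero =>
      refine ⟨fun m hm => ih m (by simpa using hm) _ ha, ?_⟩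
      simpa [ppow] using N.zero_mem
    | succ n ihn =>
      have term : ∀ i j, i + j ≤ k * (n + 1 + 1) → (i, j) ≠ (k * (n + 1), k) →
          D i (ppow a n) * D j a ∈ N := by
        intro i j hij hne
        rcases lt_or_ge j k with hj | hj
        · exact N.mul_mem_left _ _ (ih j hj _ ha)
        · refine N.mul_mem_right _ _ (ihn.1 i ?_)
          rw [mul_add k (n + 1) 1, mul_one] at hij
          rcases lt_or_ge i (k * (n + 1)) with hi | hi
          · exact hi
          · exact absurd (Prod.ext (by simp; omega) (by simp; omega)) hne
      constructor
      · intro m hm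
        rw [ppow, hmul]
        refine sum_mem fun p hp => ?_
        rw [Finset.HasAntidiagonal.mem_antidiagonal] at hp
        refine term p.1 p.2 (by omega) ?_
        intro h
        rw [Prod.ext_iff] at h
        simp only at h
        rw [mul_add k (n + 1) 1, mul_one] at hm
        omega
      · rw [ppow, hmul, ← Finset.add_sum_erase _ _
          (show (k * (n + 1), k) ∈ Finset.HasAntidiagonal.antidiagonal (k * (n + 1 + 1)) by
            rw [Finset.HasAntidiagonal.mem_antidiagonal]; ring), ppow]
        have e : ∀ s : R, D (k * (n + 1)) (ppow a n) * D k a + s - ppow (D k a) n * D k a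
            = (D (k * (n + 1)) (ppow a n) - ppow (D k a) n) * D k a + s := by
          intro s; noncomm_ring
        rw [e]
        refine N.add_mem (N.mul_mem_right _ _ ihn.2) (sum_mem fun p hp => ?_)
        rw [Finset.mem_erase, Finset.HasAntidiagonal.mem_antidiagonal] at hp
        exact term p.1 p.2 (by omega) hp.1
  have nilN : N.IsNil := nilRad_isNil R
  obtain ⟨K, hK, hKm⟩ := exists_nil_ext (I := N) (J := N) nilN (D k)
    (by
      intro r a ha
      refine ⟨r * a, N.mul_mem_left _ _ ha, ?_⟩
      rw [hmul, ← Finset.add_sum_erase _ _ (show (0, k) ∈ Finset.HasAntidiagonal.antidiagonal k by simp), h0,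
        sub_add_cancel_left]
      refine N.neg_mem (sum_mem fun p hp => ?_)
      rw [Finset.mem_erase, Finset.HasAntidiagonal.mem_antidiagonal] at hp
      refine N.mul_mem_left _ _ (ih _ ?_ _ ha)
      have : ¬ (p.1 = 0 ∧ p.2 = k) := fun h => hp.1 (Prod.ext h.1 h.2)
      omega)
    (by
      intro r a ha
      refine ⟨a * r, N.mul_mem_right _ _ ha, ?_⟩
      rw [hmul, ← Finset.add_sum_erase _ _ (show (k, 0) ∈ Finset.HasAntidiagonal.antidiagonal k by simp), h0,
        sub_add_cancel_left]
      refine N.neg_mem (sum_mem fun p hp => ?_)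
      rw [Finset.mem_erase, Finset.HasAntidiagonal.mem_antidiagonal] at hp
      refine N.mul_mem_right _ _ (ih _ ?_ _ ha)
      have : ¬ (p.1 = k ∧ p.2 = 0) := fun h => hp.1 (Prod.ext h.1 h.2)
      omega)
    (by
      intro a ha
      obtain ⟨n, hn⟩ := nilN a ha
      refine ⟨n, ?_⟩
      have := (key a ha n).2
      rw [hn, map_zero, zero_sub] at this
      simpa using N.neg_mem this)
  intro a ha
  have := hKm 0 N.zero_mem a ha
  rw [zero_add] at this
  exact le_nilRad hK this

section graded

variable {G : Type*} [AddCommGroup G] [DecidableEq G] {R : Type*} [NonUnitalRing R]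
    (ℳ : G → AddSubgroup R) [DirectSum.Decomposition ℳ]

/-- Multiply the component of degree `g` by the integer `c g`. -/
noncomputable def scale (c : G → ℤ) : R →+ R :=
  ((DirectSum.decomposeAddEquiv ℳ).symm.toAddMonoidHom.comp
    (DirectSum.map fun g => zsmulAddGroupHom (α := ℳ g) (c g))).comp
    (DirectSum.decomposeAddEquiv ℳ).toAddMonoidHom

theorem decompose_scale (c : G → ℤ) (a : R) (g : G) :
    (DirectSum.decompose ℳ (scale ℳ c a) g : R) = c g • (DirectSum.decompose ℳ a g : R) := by
  have : DirectSum.decompose ℳ (scale ℳ c a) =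
      DirectSum.map (fun g => zsmulAddGroupHom (α := ℳ g) (c g)) (DirectSum.decompose ℳ a) :=
    (DirectSum.decompose ℳ).apply_symm_apply _
  rw [this, DirectSum.map_apply]
  simp

theorem ext_decompose {a b : R}
    (h : ∀ g, (DirectSum.decompose ℳ a g : R) = DirectSum.decompose ℳ b g) : a = b := by
  apply (DirectSum.decompose ℳ).injective
  refine DFinsupp.ext fun g => ?_
  exact Subtype.ext (h g)

theorem scale_of_mem (c : G → ℤ) {a : R} {g : G} (ha : a ∈ ℳ g) : scale ℳ c a = c g • a := by
  refine ext_decompose ℳ fun h => ?_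
  rw [decompose_scale]
  by_cases hgh : g = h
  · subst hgh
    rw [DirectSum.decompose_of_mem_same _ ha,
      DirectSum.decompose_of_mem_same _ ((ℳ g).zsmul_mem ha _)]
  · rw [DirectSum.decompose_of_mem_ne _ ha hgh,
      DirectSum.decompose_of_mem_ne _ ((ℳ g).zsmul_mem ha _) hgh, smul_zero]

variable [SetLike.GradedMul ℳ]

theorem scale_mul (φ : G →+ ℤ) (k : ℕ) (a b : R) :
    scale ℳ (fun g => Ring.choose (φ g) k) (a * b) = ∑ p ∈ Finset.HasAntidiagonal.antidiagonal k,
      scale ℳ (fun g => Ring.choose (φ g) p.1) a * scale ℳ (fun g => Ring.choose (φ g) p.2) b := by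
  induction a using DirectSum.Decomposition.inductionOn ℳ with
  | zero => simp
  | add a a' h h' => simp only [add_mul, map_add, h, h', Finset.sum_add_distrib]
  | @homogeneous i a =>
    induction b using DirectSum.Decomposition.inductionOn ℳ with
    | zero => simp
    | add b b' h h' => simp only [mul_add, map_add, h, h', Finset.sum_add_distrib]
    | @homogeneous j b =>
      rw [scale_of_mem ℳ _ (SetLike.GradedMul.mul_mem a.2 b.2), map_add,
        Ring.add_choose_eq k (Commute.all _ _), Finset.sum_smul]
      refine Finset.sum_congr rfl fun p _ => ?_
      rw [scale_of_mem ℳ _ a.2, scale_of_mem ℳ _ b.2, smul_mul_smul_comm]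

theorem scale_choose_mem (φ : G →+ ℤ) (k : ℕ) (a : R) (ha : a ∈ nilRad R) :
    scale ℳ (fun g => Ring.choose (φ g) k) a ∈ nilRad R := by
  refine higher_mem (fun k => scale ℳ (fun g => Ring.choose (φ g) k)) ?_ ?_ k a ha
  · intro a
    refine ext_decompose ℳ fun h => ?_
    simp [decompose_scale, Ring.choose_zero_right]
  · intro k a b
    exact scale_mul ℳ φ k a b

theorem scale_shift_mem (φ : G →+ ℤ) (c : ℤ) (k : ℕ) (a : R) (ha : a ∈ nilRad R) :
    scale ℳ (fun g => Ring.choose (φ g + c) k) a ∈ nilRad R := by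
  have : scale ℳ (fun g => Ring.choose (φ g + c) k) a = ∑ p ∈ Finset.HasAntidiagonal.antidiagonal k,
      Ring.choose c p.2 • scale ℳ (fun g => Ring.choose (φ g) p.1) a := by
    refine ext_decompose ℳ fun h => ?_
    rw [decompose_scale, Ring.add_choose_eq k (Commute.all _ _), DirectSum.decompose_sum,
      DFinsupp.finset_sum_apply, AddSubgroup.val_finset_sum, Finset.sum_smul]
    refine Finset.sum_congr rfl fun p _ => ?_
    have e : DirectSum.decompose ℳ
        (Ring.choose c p.2 • scale ℳ (fun g => Ring.choose (φ g) p.1) a) h =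
        Ring.choose c p.2 • DirectSum.decompose ℳ
          (scale ℳ (fun g => Ring.choose (φ g) p.1) a) h := by
      have := map_zsmul (DirectSum.decomposeAddEquiv ℳ) (Ring.choose c p.2)
        (scale ℳ (fun g => Ring.choose (φ g) p.1) a)
      exact congrArg (fun x => x h) this
    rw [e, AddSubgroup.coe_zsmul, decompose_scale, smul_smul, mul_comm]
  rw [this]
  exact sum_mem fun p _ => TwoSidedIdeal.zsmul_mem _ _ (scale_choose_mem ℳ φ _ a ha)

/-- An operator preserving the nil radical, fixing degree `g` and killing degree `h`. -/
theorem exists_kill [Module.Free ℤ G] {g h : G} (hgh : g ≠ h) :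
    ∃ c : G → ℤ, c g = 1 ∧ c h = 0 ∧ ∀ a ∈ nilRad R, scale ℳ c a ∈ nilRad R := by
  obtain ⟨φ, hφ⟩ : ∃ φ : G →+ ℤ, φ h < φ g := by
    let b := Module.Free.chooseBasis ℤ G
    obtain ⟨i, hi⟩ : ∃ i, b.repr g i ≠ b.repr h i := by
      by_contra hcon
      push Not at hcon
      exact hgh (b.repr.injective (Finsupp.ext hcon))
    rcases lt_or_gt_of_ne hi with hlt | hlt
    · exact ⟨-(b.coord i).toAddMonoidHom, by simpa using hlt⟩
    · exact ⟨(b.coord i).toAddMonoidHom, by simpa using hlt⟩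
  obtain ⟨k, hk⟩ := Int.eq_ofNat_of_zero_le (sub_nonneg.2 hφ.le)
  refine ⟨fun x => Ring.choose (φ x + -φ h) k, ?_, ?_, scale_shift_mem ℳ φ _ k⟩
  · simp only [← sub_eq_add_neg, hk, Ring.choose_natCast, Nat.choose_self, Nat.cast_one]
  · simp only [add_neg_cancel]
    exact Ring.choose_zero_pos ℤ (by omega)

theorem component_mem [Module.Free ℤ G] (g : G) (s : Finset G) :
    ∀ a ∈ nilRad R, (∀ h, h ≠ g → h ∉ s → (DirectSum.decompose ℳ a h : R) = 0) →
      (DirectSum.decompose ℳ a g : R) ∈ nilRad R := by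
  induction s using Finset.induction_on with
  | empty =>
    intro a ha hs
    have : (DirectSum.decompose ℳ a g : R) = a := by
      refine ext_decompose ℳ fun h => ?_
      by_cases hh : h = g
      · subst hh
        rw [DirectSum.decompose_of_mem_same _ (DirectSum.decompose ℳ a h).2]
      · rw [hs h hh (by simp),
          DirectSum.decompose_of_mem_ne _ (DirectSum.decompose ℳ a g).2 (Ne.symm hh)]
    rwa [this]
  | insert x s _ ih =>
    intro a ha hs
    by_cases hx : x = g
    · exact ih a ha fun h hne hns => hs h hne (by simp [hns, hx, hne])
    · obtain ⟨c, hc1, hc0, hc⟩ := exists_kill (R := R) ℳ (Ne.symm hx)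
      have := ih (scale ℳ c a) (hc a ha) (by
        intro h hne hns
        rw [decompose_scale]
        by_cases hhx : h = x
        · rw [hhx, hc0, zero_smul]
        · rw [hs h hne (by simp [hns, hhx]), smul_zero])
      rwa [decompose_scale, hc1, one_smul] at this

end graded

end NilRadAux

/-- **The nil radical of a ring graded by a free abelian group is homogeneous.**  If `G` is a
free abelian group (written additively, i.e. a free `ℤ`-module) and `R = ⊕_{g ∈ G} R_g` is a
`G`-graded (associative, not necessarily unital) ring, then every homogeneous component of every
element of the nil radical again lies in the nil radical. -/
theorem nilRad_homogeneous_of_free_abelian_graded {G : Type*} [AddCommGroup G]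
    [Module.Free ℤ G] [DecidableEq G] {R : Type*} [NonUnitalRing R]
    (ℳ : G → AddSubgroup R) [SetLike.GradedMul ℳ] [DirectSum.Decomposition ℳ]
    (a : R) (ha : a ∈ nilRad R) (g : G) :
    (DirectSum.decompose ℳ a g : R) ∈ nilRad R := by
  classical
  refine NilRadAux.component_mem ℳ g (DFinsupp.support (DirectSum.decompose ℳ a)) a ha ?_
  intro h _ hns
  have := DFinsupp.notMem_support_iff.1 hns
  rw [this, ZeroMemClass.coe_zero]
end

section
/- Let R = ⊕_{i=1}^∞ R_i be a ring graded by the additive semigroup of positive integers. If R is graded-nil (every homogeneous element of R is nilpotent), then R is Brown–McCoy radical; that is, R has no ideal I such that the quotient ring R/I is a simple ring with an identity element. -/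
section Helpers

/-- Sums `g 0 + ... + g (w-1)` with `g j` of degree `M + j`. -/
def winGrp {Q : Type*} [NonUnitalRing Q] (S : ℕ → AddSubgroup Q) (M w : ℕ) : AddSubgroup Q where
  carrier := {x | ∃ g : ℕ → Q, (∀ j, g j ∈ S (M + j)) ∧ x = ∑ j ∈ Finset.range w, g j}
  zero_mem' := ⟨fun _ => 0, fun j => (S (M + j)).zero_mem, by simp⟩
  add_mem' := by
    rintro x y ⟨g, hg, rfl⟩ ⟨h, hh, rfl⟩
    exact ⟨fun j => g j + h j, fun j => (S _).add_mem (hg j) (hh j), by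
      rw [Finset.sum_add_distrib]⟩
  neg_mem' := by
    rintro x ⟨g, hg, rfl⟩
    exact ⟨fun j => - g j, fun j => (S _).neg_mem (hg j), by simp⟩

variable {Q : Type*} [NonUnitalRing Q] (S : ℕ → AddSubgroup Q)

theorem mem_winGrp {M w : ℕ} {x : Q} : x ∈ winGrp S M w ↔
    ∃ g : ℕ → Q, (∀ j, g j ∈ S (M + j)) ∧ x = ∑ j ∈ Finset.range w, g j := Iff.rfl

theorem single_winGrp {M w d : ℕ} {x : Q} (j : ℕ) (hj : j < w) (hd : d = M + j)
    (hx : x ∈ S d) : x ∈ winGrp S M w := by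
  subst hd
  refine ⟨fun i => if i = j then x else 0, fun i => ?_, ?_⟩
  · by_cases h : i = j
    · subst h; simpa using hx
    · simp [h]
  · simp [hj]

theorem winGrp_le {M w : ℕ} (H : AddSubgroup Q) (h : ∀ j < w, ∀ x ∈ S (M + j), x ∈ H) :
    winGrp S M w ≤ H := by
  rintro x ⟨g, hg, rfl⟩
  exact sum_mem fun j hj => h j (Finset.mem_range.1 hj) _ (hg j)

theorem winGrp_mono {M w w' : ℕ} (hw : w ≤ w') : winGrp S M w ≤ winGrp S M w' :=
  winGrp_le S _ fun j hj _ hx => single_winGrp S j (by omega) rfl hx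

/-- Elements lying in all windows of width `w` starting far enough. -/
def evGrp (w : ℕ) : AddSubgroup Q where
  carrier := {x | ∃ M₀, ∀ M, M₀ ≤ M → x ∈ winGrp S M w}
  zero_mem' := ⟨0, fun _ _ => zero_mem _⟩
  add_mem' := by
    rintro x y ⟨m, hm⟩ ⟨n, hn⟩
    exact ⟨max m n, fun M hM => add_mem (hm M (by omega)) (hn M (by omega))⟩
  neg_mem' := by
    rintro x ⟨m, hm⟩
    exact ⟨m, fun M hM => neg_mem (hm M hM)⟩

/-- A nontrivial relation of spread at most `n`. -/
def HasRel (n : ℕ) : Prop :=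
  ∃ (k : ℕ) (g : ℕ → Q), (∀ j, g j ∈ S (k + j)) ∧ ∑ j ∈ Finset.range (n + 1), g j = 0 ∧
    ∃ j, j ≤ n ∧ g j ≠ 0

/-- The ideal of `x` with `u x v ∈ H` for all `u, v`. -/
def coreIdeal (H : AddSubgroup Q) : TwoSidedIdeal Q :=
  TwoSidedIdeal.mk' {x | ∀ u v : Q, u * x * v ∈ H}
    (by intro u v; simp)
    (by intro x y hx hy u v; rw [mul_add, add_mul]; exact add_mem (hx u v) (hy u v))
    (by intro x hx u v; rw [mul_neg, neg_mul]; exact neg_mem (hx u v))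
    (by intro x y hy u v; rw [← mul_assoc u x y]; exact hy _ _)
    (by intro x y hx u v
        have := hx u (y * v)
        rwa [← mul_assoc, mul_assoc u x y] at this)

theorem mem_coreIdeal (H : AddSubgroup Q) (x : Q) :
    x ∈ coreIdeal H ↔ ∀ u v : Q, u * x * v ∈ H := by
  unfold coreIdeal
  rw [TwoSidedIdeal.mem_mk']
  rfl

/-- Annihilator of a central element. -/
def annIdeal (c : Q) (hc : ∀ s, s * c = c * s) : TwoSidedIdeal Q :=
  TwoSidedIdeal.mk' {x | x * c = 0}
    (by simp)
    (by intro x y hx hy; simp only [Set.mem_ofPred_eq] at *; rw [add_mul, hx, hy, add_zero])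
    (by intro x hx; simp only [Set.mem_ofPred_eq] at *; rw [neg_mul, hx, neg_zero])
    (by intro x y hy; simp only [Set.mem_ofPred_eq] at *; rw [mul_assoc, hy, mul_zero])
    (by intro x y hx; simp only [Set.mem_ofPred_eq] at *
        rw [mul_assoc, hc, ← mul_assoc, hx, zero_mul])

theorem mem_annIdeal (c : Q) (hc : ∀ s, s * c = c * s) (x : Q) :
    x ∈ annIdeal c hc ↔ x * c = 0 := by
  unfold annIdeal
  rw [TwoSidedIdeal.mem_mk']
  rfl

theorem key_aux (h0 : S 0 = ⊥)
    (hmul : ∀ i j x y, x ∈ S i → y ∈ S j → x * y ∈ S (i + j))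
    (hspan : ∀ H : AddSubgroup Q, (∀ i, S i ≤ H) → H = ⊤)
    (hnil : ∀ i, ∀ x ∈ S i, IsNilElem x)
    (hsimple : ∀ J : TwoSidedIdeal Q, J = ⊥ ∨ J = ⊤)
    (hnt : Nontrivial Q) (e : Q) (he : ∀ x, e * x = x ∧ x * e = x) : False := by
  have hmul' : ∀ {i j d x y}, x ∈ S i → y ∈ S j → d = i + j → x * y ∈ S d := by
    intro i j d x y hx hy hd; subst hd; exact hmul _ _ _ _ hx hy
  have e0 : e ≠ 0 := by
    rintro rfl
    obtain ⟨x, hx⟩ := exists_ne (0 : Q)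
    exact hx (by rw [← (he x).1, zero_mul])
  -- some window contains `e`
  obtain ⟨m, hm⟩ : ∃ m, e ∈ winGrp S 1 m := by
    let H : AddSubgroup Q :=
      { carrier := {x | ∃ m, x ∈ winGrp S 1 m}
        zero_mem' := ⟨0, zero_mem _⟩
        add_mem' := by
          rintro x y ⟨m, hm⟩ ⟨n, hn⟩
          exact ⟨max m n, add_mem (winGrp_mono S (le_max_left _ _) hm)
            (winGrp_mono S (le_max_right _ _) hn)⟩
        neg_mem' := by
          rintro x ⟨m, hm⟩
          exact ⟨m, neg_mem hm⟩ }
    have : H = ⊤ := by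
      apply hspan
      intro i x hx
      rcases i with _ | i
      · rw [h0, AddSubgroup.mem_bot] at hx
        subst hx; exact zero_mem _
      · exact ⟨i + 1, single_winGrp S i (by omega) (by omega) hx⟩
    have h2 : e ∈ H := this ▸ AddSubgroup.mem_top e
    exact h2
  have hall : ∀ M, e ∈ winGrp S (M + 1) m := by
    intro M
    induction M with
    | zero => simpa using hm
    | succ M ih =>
      refine winGrp_le S (winGrp S (M + 1 + 1) m) ?_ ih
      intro j hj x hx
      rcases j with _ | j
      · obtain ⟨g, hg, hge⟩ := hm
        rw [← (he x).2, hge, Finset.mul_sum]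
        exact sum_mem fun i hi => single_winGrp S i (Finset.mem_range.1 hi) rfl
          (hmul' hx (hg i) (by omega))
      · exact single_winGrp S j (by omega) (by omega) hx
  -- relations exist
  have hrel : ∃ n, HasRel S n := by
    obtain ⟨i, s, hs, hs0⟩ : ∃ i, ∃ s ∈ S i, s ≠ 0 := by
      by_contra! hcon
      have : (⊥ : AddSubgroup Q) = ⊤ :=
        hspan ⊥ fun i x hx => (AddSubgroup.mem_bot).2 (hcon i x hx)
      exact e0 ((AddSubgroup.mem_bot).1 (this ▸ AddSubgroup.mem_top e))
    obtain ⟨g, hg, hge⟩ := hm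
    refine ⟨m, i, fun j => if j = 0 then s else - (s * g (j - 1)), ?_, ?_, 0, by omega, ?_⟩
    · intro j
      rcases j with _ | j
      · simpa using hs
      · simpa using hmul' hs (hg j) (by omega)
    · rw [Finset.sum_range_succ']
      simp only [Nat.add_eq_zero_iff, one_ne_zero, and_false, if_false, if_true,
        Nat.add_sub_cancel, Finset.sum_neg_distrib]
      rw [← Finset.mul_sum, ← hge, (he s).2]
      simp
    · simpa using hs0
  classical
  obtain ⟨n, hn, hmin⟩ : ∃ n, HasRel S n ∧ ∀ k < n, ¬ HasRel S k :=
    ⟨Nat.find hrel, Nat.find_spec hrel, fun k hk => Nat.find_min hrel hk⟩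
  obtain ⟨k, g, hg, hsum, j₀, hj₀, hgj⟩ := hn
  obtain ⟨n, rfl⟩ : ∃ n', n = n' + 1 := by
    rcases n with _ | n
    · exfalso
      obtain rfl : j₀ = 0 := by omega
      exact hgj (by simpa using hsum)
    · exact ⟨n, rfl⟩
  have ha : g (n + 1) ≠ 0 := by
    intro ha
    refine hmin n (by omega) ⟨k, g, hg, ?_, j₀, ?_, hgj⟩
    · rwa [Finset.sum_range_succ, ha, add_zero] at hsum
    · rcases Nat.lt_or_ge j₀ (n + 1) with h | h
      · omega
      · obtain rfl : j₀ = n + 1 := by omega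
        exact absurd ha hgj
  have hae : g (n + 1) = ∑ i ∈ Finset.range (n + 1), - g i := by
    rw [Finset.sum_range_succ] at hsum
    rw [Finset.sum_neg_distrib]
    exact eq_neg_of_add_eq_zero_right hsum
  -- narrowing the window
  have hstep : ∀ w, n + 1 ≤ w → e ∈ evGrp S (w + 1) → e ∈ evGrp S w := by
    rintro w hw ⟨M₁, hM₁⟩
    have hom : ∀ p q u v, u ∈ S p → v ∈ S q → u * g (n + 1) * v ∈ evGrp S w := by
      intro p q u v hu hv
      refine ⟨M₁ + (p + (k + (n + 1)) + q), fun M hM => ?_⟩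
      obtain ⟨h, hh, hhe⟩ := hM₁ (M - (p + (k + (n + 1)) + q)) (by omega)
      rw [← (he (u * g (n + 1) * v)).2, hhe, Finset.sum_range_succ, mul_add, Finset.mul_sum]
      refine add_mem (sum_mem fun i hi => ?_) ?_
      · exact single_winGrp S i (Finset.mem_range.1 hi) rfl
          (hmul' (hmul' (hmul' hu (hg _) rfl) hv rfl) (hh i) (by omega))
      · rw [hae, Finset.mul_sum, Finset.sum_mul, Finset.sum_mul]
        refine sum_mem fun i hi => ?_
        have hi' := Finset.mem_range.1 hi
        exact single_winGrp S (w - (n + 1) + i) (by omega) rfl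
          (hmul' (hmul' (hmul' hu (neg_mem (hg i)) rfl) hv rfl) (hh w) (by omega))
    have hom2 : ∀ p u, u ∈ S p → ∀ v, u * g (n + 1) * v ∈ evGrp S w := by
      intro p u hu v
      have := hspan ((evGrp S w).comap (AddMonoidHom.mulLeft (u * g (n + 1))))
        (fun q v hv => hom p q u v hu hv)
      have h2 : v ∈ (evGrp S w).comap (AddMonoidHom.mulLeft (u * g (n + 1))) :=
        this ▸ AddSubgroup.mem_top v
      exact h2
    have hom3 : ∀ u v, u * g (n + 1) * v ∈ evGrp S w := by
      intro u v
      have := hspan ((evGrp S w).comap (AddMonoidHom.mulRight (g (n + 1) * v)))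
        (fun p u hu => by
          have := hom2 p u hu v
          rw [mul_assoc] at this
          exact this)
      have h2 : u ∈ (evGrp S w).comap (AddMonoidHom.mulRight (g (n + 1) * v)) :=
        this ▸ AddSubgroup.mem_top u
      rw [mul_assoc]
      exact h2
    have hmem : g (n + 1) ∈ coreIdeal (evGrp S w) := (mem_coreIdeal _ _).2 hom3
    rcases hsimple (coreIdeal (evGrp S w)) with h | h
    · rw [h, TwoSidedIdeal.mem_bot] at hmem
      exact absurd hmem ha
    · have h1 : e ∈ coreIdeal (evGrp S w) := by rw [h]; trivial
      have h2 := (mem_coreIdeal _ _).1 h1 e e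
      rwa [(he _).1, (he _).1] at h2
  have hdown : ∀ t, e ∈ evGrp S (n + 1 + t) → e ∈ evGrp S (n + 1) := by
    intro t
    induction t with
    | zero => exact id
    | succ t ih => exact fun h => ih (hstep (n + 1 + t) (by omega) h)
  obtain ⟨M, hM⟩ := hdown m ⟨1, fun M hM => by
    obtain ⟨M, rfl⟩ : ∃ M', M = M' + 1 := ⟨M - 1, by omega⟩
    exact winGrp_mono S (by omega) (hall M)⟩
  obtain ⟨c, hc, hce⟩ := hM M le_rfl
  have hcomm1 : ∀ j < n + 1, ∀ i, ∀ s ∈ S i, s * c j - c j * s = 0 := by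
    intro j hj i s hs
    by_contra hne
    refine hmin n (by omega) ⟨i + M, fun j => s * c j - c j * s, fun j => ?_, ?_, j, by omega, hne⟩
    · exact sub_mem (hmul' hs (hc j) (by omega)) (hmul' (hc j) hs (by omega))
    · rw [Finset.sum_sub_distrib, ← Finset.mul_sum, ← Finset.sum_mul, ← hce, (he s).1, (he s).2,
        sub_self]
  obtain ⟨j, hj, hcj⟩ : ∃ j < n + 1, c j ≠ 0 := by
    by_contra! hcon
    exact e0 (hce.trans (Finset.sum_eq_zero fun j hj => hcon j (Finset.mem_range.1 hj)))
  have hcomm : ∀ s, s * c j = c j * s := by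
    intro s
    have := hspan ((AddMonoidHom.mulRight (c j) - AddMonoidHom.mulLeft (c j)).ker)
      (fun i s hs => hcomm1 j hj i s hs)
    have h2 : s ∈ (AddMonoidHom.mulRight (c j) - AddMonoidHom.mulLeft (c j)).ker :=
      this ▸ AddSubgroup.mem_top s
    exact sub_eq_zero.1 h2
  rcases hsimple (annIdeal (c j) hcomm) with h | h
  · have hnz : ∀ N, ppow (c j) N ≠ 0 := by
      intro N
      induction N with
      | zero => exact hcj
      | succ N ih =>
        intro h3
        have : ppow (c j) N ∈ annIdeal (c j) hcomm := (mem_annIdeal _ _ _).2 h3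
        rw [h, TwoSidedIdeal.mem_bot] at this
        exact ih this
    obtain ⟨N, hN⟩ := hnil _ _ (hc j)
    exact hnz N hN
  · have h1 : e ∈ annIdeal (c j) hcomm := by rw [h]; trivial
    have h2 := (mem_annIdeal _ _ _).1 h1
    rw [(he _).1] at h2
    exact hcj h2

end Helpers

/-- **Graded-nil rings graded by the positive integers are Brown–McCoy radical.**
Let `R = ⊕_{i ≥ 1} Rᵢ` be a ring graded by the additive semigroup of positive integers in which
every homogeneous element is nilpotent.  Then `R` has no two-sided ideal `I` such that the
quotient ring `R/I` is a simple ring with an identity element. -/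
theorem brownMcCoy_radical_of_gradedNil {R : Type*} [NonUnitalRing R]
    (ℳ : ℕ+ → AddSubgroup R) [SetLike.GradedMul ℳ] [DirectSum.Decomposition ℳ]
    (hnil : ∀ i : ℕ+, ∀ x ∈ ℳ i, IsNilElem x) :
    ¬ ∃ I : TwoSidedIdeal R,
        Nontrivial I.ringCon.Quotient ∧
        (∀ J : TwoSidedIdeal I.ringCon.Quotient, J = ⊥ ∨ J = ⊤) ∧
        (∃ e : I.ringCon.Quotient, ∀ x : I.ringCon.Quotient, e * x = x ∧ x * e = x) := by
  classical
  rintro ⟨I, hnt, hsimple, e, he⟩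
  let φ : R →+ I.ringCon.Quotient :=
    { toFun := fun x => (x : I.ringCon.Quotient)
      map_zero' := rfl
      map_add' := fun _ _ => rfl }
  have hφm : ∀ x y, φ (x * y) = φ x * φ y := fun _ _ => rfl
  have hφs : ∀ q, ∃ x, φ x = q := fun q => Quotient.inductionOn' q fun x => ⟨x, rfl⟩
  have hφp : ∀ x n, φ (ppow x n) = ppow (φ x) n := by
    intro x n
    induction n with
    | zero => rfl
    | succ n ih => rw [ppow, hφm, ih, ppow]
  let S : ℕ → AddSubgroup I.ringCon.Quotient :=
    fun i => if h : 0 < i then (ℳ ⟨i, h⟩).map φ else ⊥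
  have hS : ∀ i (h : 0 < i), S i = (ℳ ⟨i, h⟩).map φ := fun i h => dif_pos h
  have h0 : S 0 = ⊥ := dif_neg (by omega)
  refine key_aux S h0 ?_ ?_ ?_ hsimple hnt e he
  · intro i j x y hx hy
    rcases Nat.eq_zero_or_pos i with rfl | hi
    · rw [h0, AddSubgroup.mem_bot] at hx
      rw [hx, zero_mul]; exact zero_mem _
    rcases Nat.eq_zero_or_pos j with rfl | hj
    · rw [h0, AddSubgroup.mem_bot] at hy
      rw [hy, mul_zero]; exact zero_mem _
    rw [hS i hi] at hx
    rw [hS j hj] at hy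
    rw [hS (i + j) (by omega)]
    obtain ⟨a, ha, rfl⟩ := hx
    obtain ⟨b, hb, rfl⟩ := hy
    have hab : a * b ∈ ℳ (⟨i, hi⟩ + ⟨j, hj⟩) := SetLike.GradedMul.mul_mem ha hb
    exact ⟨a * b, hab, hφm a b⟩
  · intro H hH
    rw [eq_top_iff]
    intro q _
    obtain ⟨x, rfl⟩ := hφs q
    rw [← DirectSum.sum_support_decompose ℳ x, map_sum]
    refine sum_mem fun i _ => hH i ?_
    rw [hS i i.pos]
    exact ⟨_, SetLike.coe_mem _, rfl⟩
  · intro i x hx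
    rcases Nat.eq_zero_or_pos i with rfl | hi
    · rw [h0, AddSubgroup.mem_bot] at hx
      exact ⟨0, hx⟩
    rw [hS i hi] at hx
    obtain ⟨a, ha, rfl⟩ := hx
    obtain ⟨N, hN⟩ := hnil _ a ha
    exact ⟨N, by rw [← hφp, hN, map_zero]⟩
end
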